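/- Under the Tikhonov EKI setup with the regularity assumption on H, there exist constants κ_m, κ_M > 0 (depending on the problem data and on the initial ensemble) such that for every n ≥ 1 the sample covariance satisfies κ_m n^{γ−β−1} I ⪯ C_n^{uu} ⪯ κ_M n^{γ−β−1} I in the Loewner order. -/

import Mathlib

open scoped BigOperators
open Matrix

noncomputable section

/-- Euclidean norm of a vector `v : Fin d → ℝ`. -/
def evNorm {d : ℕ} (v : Fin d → ℝ) : ℝ := Real.sqrt (∑ i, v i ^ 2)

/-- Spectral (ℓ²-operator) norm of a real matrix. -/
def spNorm {p q : ℕ} (A : Matrix (Fin p) (Fin q) ℝ) : ℝ :=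
  sSup {r : ℝ | ∃ v : Fin q → ℝ, evNorm v ≤ 1 ∧ r = evNorm (A.mulVec v)}

/-- Smallest eigenvalue (Rayleigh quotient infimum) of a square matrix. -/
def lambdaMin {d : ℕ} (A : Matrix (Fin d) (Fin d) ℝ) : ℝ :=
  sInf {r : ℝ | ∃ v : Fin d → ℝ, evNorm v = 1 ∧ r = v ⬝ᵥ A.mulVec v}

/-- Loewner order `A ⪯ B` : `B - A` is positive semidefinite. -/
def loewnerLE {d : ℕ} (A B : Matrix (Fin d) (Fin d) ℝ) : Prop := (B - A).PosSemidef

/-- Sample mean of an ensemble of `K` vectors. -/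
def sMean {K d : ℕ} (u : Fin K → Fin d → ℝ) : Fin d → ℝ := (K : ℝ)⁻¹ • ∑ i, u i

/-- Sample (cross-)covariance of two ensembles. -/
def sCov {K p q : ℕ} (a : Fin K → Fin p → ℝ) (b : Fin K → Fin q → ℝ) :
    Matrix (Fin p) (Fin q) ℝ :=
  (K : ℝ)⁻¹ • ∑ i, Matrix.of (fun j l => (a i j - sMean a j) * (b i l - sMean b l))

/-- Jacobian matrix of a map between finite-dimensional coordinate spaces. -/
def jac {a b : ℕ} (H : (Fin a → ℝ) → Fin b → ℝ) (x : Fin a → ℝ) :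
    Matrix (Fin b) (Fin a) ℝ :=
  Matrix.of fun i j => fderiv ℝ H x (Pi.single j 1) i

/-- Gradient (coordinate) vector of a scalar function. -/
def gradVec {d : ℕ} (f : (Fin d → ℝ) → ℝ) (x : Fin d → ℝ) : Fin d → ℝ :=
  fun j => fderiv ℝ f x (Pi.single j 1)

/-- The augmented (Tikhonov) observation map `u ↦ (G u, u)`. -/
def aug {du dy : ℕ} (G : (Fin du → ℝ) → Fin dy → ℝ) (u : Fin du → ℝ) :
    Fin (dy + du) → ℝ :=
  Fin.append (G u) u

/-- The augmented noise covariance `Γ₊ = blockdiag(Γ, I)`. -/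
def gammaPlus {dy du : ℕ} (Γ : Matrix (Fin dy) (Fin dy) ℝ) :
    Matrix (Fin (dy + du)) (Fin (dy + du)) ℝ :=
  Matrix.reindex finSumFinEquiv finSumFinEquiv (Matrix.fromBlocks Γ 0 0 1)

/-- `C^{uu}`: sample covariance of the ensemble. -/
def Cuu {K du : ℕ} (u : Fin K → Fin du → ℝ) : Matrix (Fin du) (Fin du) ℝ := sCov u u

/-- `C^{up}`: sample cross-covariance of the ensemble and its (augmented) observations. -/
def Cup {K du dy : ℕ} (G : (Fin du → ℝ) → Fin dy → ℝ) (u : Fin K → Fin du → ℝ) :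
    Matrix (Fin du) (Fin (dy + du)) ℝ :=
  sCov u (fun i => aug G (u i))

/-- `C^{pp}`: sample covariance of the (augmented) observations. -/
def Cpp {K du dy : ℕ} (G : (Fin du → ℝ) → Fin dy → ℝ) (u : Fin K → Fin du → ℝ) :
    Matrix (Fin (dy + du)) (Fin (dy + du)) ℝ :=
  sCov (fun i => aug G (u i)) (fun i => aug G (u i))


lemma form_sCov {K p q : ℕ} (a : Fin K → Fin p → ℝ) (b : Fin K → Fin q → ℝ)
    (w : Fin p → ℝ) (v : Fin q → ℝ) :
    w ⬝ᵥ (sCov a b) *ᵥ v =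
      (K : ℝ)⁻¹ * ∑ i, (w ⬝ᵥ (a i - sMean a)) * (v ⬝ᵥ (b i - sMean b)) := by
  unfold sCov
  rw [Matrix.smul_mulVec, dotProduct_smul, smul_eq_mul, Matrix.sum_mulVec, dotProduct_sum]
  congr 1
  refine Finset.sum_congr rfl fun i _ => ?_
  simp only [dotProduct, mulVec, Matrix.of_apply, Pi.sub_apply, Finset.mul_sum, Finset.sum_mul]
  rw [Finset.sum_comm]
  refine Finset.sum_congr rfl fun j _ => Finset.sum_congr rfl fun k _ => ?_
  ring

lemma sCov_transpose {K p q : ℕ} (a : Fin K → Fin p → ℝ) (b : Fin K → Fin q → ℝ) :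
    (sCov a b)ᵀ = sCov b a := by
  ext i j
  simp [sCov, Matrix.sum_apply, mul_comm]

lemma form_inv_eq {p q : ℕ} (B : Matrix (Fin p) (Fin q) ℝ) (S : Matrix (Fin q) (Fin q) ℝ)
    (hS : S.PosDef) (v : Fin p → ℝ) :
    ∃ w : Fin q → ℝ, v ⬝ᵥ (B * S⁻¹ * Bᵀ) *ᵥ v = v ⬝ᵥ B *ᵥ w ∧ S *ᵥ w = Bᵀ *ᵥ v := by
  refine ⟨S⁻¹ *ᵥ (Bᵀ *ᵥ v), ?_, ?_⟩
  · simp only [mulVec_mulVec, Matrix.mul_assoc]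
  · rw [mulVec_mulVec, Matrix.mul_nonsing_inv _ ((Matrix.isUnit_iff_isUnit_det S).1 hS.isUnit),
      one_mulVec]

lemma dot_symm {q : ℕ} (S : Matrix (Fin q) (Fin q) ℝ) (hS : Sᵀ = S) (x y : Fin q → ℝ) :
    x ⬝ᵥ S *ᵥ y = y ⬝ᵥ S *ᵥ x := by
  rw [dotProduct_mulVec, ← mulVec_transpose, hS, dotProduct_comm]

lemma dot_transpose {p q : ℕ} (B : Matrix (Fin p) (Fin q) ℝ) (v : Fin p → ℝ) (w : Fin q → ℝ) :
    w ⬝ᵥ Bᵀ *ᵥ v = v ⬝ᵥ B *ᵥ w := by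
  rw [mulVec_transpose, dotProduct_comm, ← dotProduct_mulVec]

lemma form_inv_ge {p q : ℕ} (B : Matrix (Fin p) (Fin q) ℝ) (S : Matrix (Fin q) (Fin q) ℝ)
    (hS : S.PosDef) (v : Fin p → ℝ) (x : Fin q → ℝ) :
    2 * (v ⬝ᵥ B *ᵥ x) - x ⬝ᵥ S *ᵥ x ≤ v ⬝ᵥ (B * S⁻¹ * Bᵀ) *ᵥ v := by
  obtain ⟨w, h1, h2⟩ := form_inv_eq B S hS v
  have hsym : Sᵀ = S := by simpa using hS.isHermitian.eq
  have h3 := hS.posSemidef.dotProduct_mulVec_nonneg (w - x)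
  simp only [star_trivial, mulVec_sub, sub_dotProduct, dotProduct_sub] at h3
  have h4 : x ⬝ᵥ S *ᵥ w = v ⬝ᵥ B *ᵥ x := by rw [h2, dot_transpose]
  have h5 : w ⬝ᵥ S *ᵥ w = v ⬝ᵥ B *ᵥ w := by rw [h2, dot_transpose]
  have h6 := dot_symm S hsym w x
  rw [h1]
  linarith

lemma cov_upper {p q : ℕ} (C : Matrix (Fin p) (Fin p) ℝ) (B : Matrix (Fin p) (Fin q) ℝ)
    (P S : Matrix (Fin q) (Fin q) ℝ) (hS : S.PosDef) (v : Fin p → ℝ) (x : Fin q → ℝ)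
    (c h : ℝ) (hc : 0 < c) (hh : 0 < h)
    (hC : v ⬝ᵥ C *ᵥ v ≤ c * (v ⬝ᵥ v))
    (hB : v ⬝ᵥ B *ᵥ x = v ⬝ᵥ C *ᵥ v)
    (hSx : x ⬝ᵥ S *ᵥ x = v ⬝ᵥ C *ᵥ v + h⁻¹ * (v ⬝ᵥ v)) :
    v ⬝ᵥ C *ᵥ v - v ⬝ᵥ (B * S⁻¹ * Bᵀ) *ᵥ v ≤ c / (1 + h * c) * (v ⬝ᵥ v) := by
  have hp : 0 < 1 + h * c := by positivity
  have h1 := form_inv_ge B S hS v ((h * c / (1 + h * c)) • x)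
  simp only [mulVec_smul, dotProduct_smul, smul_dotProduct, smul_eq_mul, hB, hSx] at h1
  set Q := v ⬝ᵥ C *ᵥ v
  set N := v ⬝ᵥ v
  have h2 : c / (1 + h * c) * N - (Q - (2 * (h * c / (1 + h * c) * Q)
      - h * c / (1 + h * c) * (h * c / (1 + h * c) * (Q + h⁻¹ * N))))
      = (c * N - Q) / (1 + h * c) ^ 2 := by
    field_simp
    ring
  have h3 : 0 ≤ (c * N - Q) / (1 + h * c) ^ 2 := div_nonneg (by linarith) (by positivity)
  linarith

lemma cov_lower {p q : ℕ} (C : Matrix (Fin p) (Fin p) ℝ) (B : Matrix (Fin p) (Fin q) ℝ)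
    (P S : Matrix (Fin q) (Fin q) ℝ) (hS : S.PosDef) (v : Fin p → ℝ)
    (τ ε : ℝ) (hτ : 0 ≤ τ) (hε : 0 < ε)
    (hC0 : 0 ≤ v ⬝ᵥ C *ᵥ v)
    (hP : ∀ w, w ⬝ᵥ P *ᵥ w ≤ τ * (w ⬝ᵥ w))
    (hSP : ∀ w, w ⬝ᵥ P *ᵥ w + ε * (w ⬝ᵥ w) ≤ w ⬝ᵥ S *ᵥ w)
    (hCS : ∀ w, (v ⬝ᵥ B *ᵥ w) ^ 2 ≤ (v ⬝ᵥ C *ᵥ v) * (w ⬝ᵥ P *ᵥ w)) :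
    (v ⬝ᵥ C *ᵥ v) / (1 + τ / ε) ≤ v ⬝ᵥ C *ᵥ v - v ⬝ᵥ (B * S⁻¹ * Bᵀ) *ᵥ v := by
  obtain ⟨w, h1, h2⟩ := form_inv_eq B S hS v
  have h5 : w ⬝ᵥ S *ᵥ w = v ⬝ᵥ B *ᵥ w := by rw [h2, dot_transpose]
  have hq := hS.posSemidef.dotProduct_mulVec_nonneg w
  simp only [star_trivial] at hq
  rw [h1]
  have e1 := hP w
  have e2 := hSP w
  have e3 := hCS w
  rw [h5] at e2 hq
  set Q := v ⬝ᵥ C *ᵥ v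
  set r := v ⬝ᵥ B *ᵥ w
  set T := w ⬝ᵥ P *ᵥ w
  set N := w ⬝ᵥ w
  have hp : 0 < τ + ε := by positivity
  -- (τ + ε) T ≤ τ r
  have k1 : (τ + ε) * T ≤ τ * r := by nlinarith
  have k2 : (τ + ε) * r ≤ τ * Q := by
    rcases hq.eq_or_lt with h | h
    · rw [← h]; simpa using mul_nonneg hτ hC0
    · have : r * ((τ + ε) * r) ≤ r * (τ * Q) := by nlinarith
      exact le_of_mul_le_mul_left this h
  have : Q / (1 + τ / ε) = ε * Q / (τ + ε) := by field_simp; ring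
  rw [this, div_le_iff₀ hp]
  nlinarith

lemma posDef_lower {d : ℕ} (A : Matrix (Fin d) (Fin d) ℝ) (hA : A.PosDef) :
    ∃ c : ℝ, 0 < c ∧ ∀ v, c * (v ⬝ᵥ v) ≤ v ⬝ᵥ A *ᵥ v := by
  have hdet := (Matrix.isUnit_iff_isUnit_det A).1 hA.isUnit
  have hsym : Aᵀ = A := by simpa using hA.isHermitian.eq
  set D := A⁻¹ with hD
  -- crude bound on the inverse
  have hup : ∀ v : Fin d → ℝ, v ⬝ᵥ D *ᵥ v ≤ (∑ i, ∑ j, |D i j| + 1) * (v ⬝ᵥ v) := by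
    intro v
    have hsq : ∀ i, v i ^ 2 ≤ v ⬝ᵥ v := fun i => by
      have := Finset.single_le_sum (f := fun i => v i * v i)
        (fun j _ => mul_self_nonneg (v j)) (Finset.mem_univ i)
      simpa [dotProduct, sq] using this
    have hn : 0 ≤ v ⬝ᵥ v := by simpa using dotProduct_star_self_nonneg v
    have : v ⬝ᵥ D *ᵥ v ≤ ∑ i, ∑ j, |D i j| * (v ⬝ᵥ v) := by
      simp only [dotProduct, mulVec, Finset.mul_sum]
      refine Finset.sum_le_sum fun i _ => Finset.sum_le_sum fun j _ => ?_
      rw [← Finset.mul_sum]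
      change _ ≤ |D i j| * (v ⬝ᵥ v)
      have h1 : v i * v j ≤ v ⬝ᵥ v := by nlinarith [hsq i, hsq j, sq_nonneg (v i - v j)]
      have h2 : -(v i * v j) ≤ v ⬝ᵥ v := by nlinarith [hsq i, hsq j, sq_nonneg (v i + v j)]
      calc v i * (D i j * v j) ≤ |v i * (D i j * v j)| := le_abs_self _
        _ = |D i j| * |v i * v j| := by rw [← abs_mul]; congr 1; ring
        _ ≤ _ := mul_le_mul_of_nonneg_left (abs_le.2 ⟨by linarith, h1⟩) (abs_nonneg _)
    rw [add_mul, Finset.sum_mul]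
    simp only [Finset.sum_mul]
    linarith
  have hpos : 0 < (∑ i, ∑ j, |D i j| + 1) := by positivity
  set M := (∑ i, ∑ j, |D i j| + 1)
  refine ⟨M⁻¹, by positivity, fun v => ?_⟩
  have h := hA.posSemidef.dotProduct_mulVec_nonneg (v - M⁻¹ • (D *ᵥ v))
  have hAD : A *ᵥ (D *ᵥ v) = v := by
    rw [mulVec_mulVec, hD, Matrix.mul_nonsing_inv _ hdet, one_mulVec]
  simp only [star_trivial, mulVec_sub, sub_dotProduct, dotProduct_sub, mulVec_smul,
    dotProduct_smul, smul_dotProduct, smul_eq_mul, hAD] at h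
  rw [dot_symm A hsym (D *ᵥ v) v, hAD] at h
  rw [dotProduct_comm (D *ᵥ v) v] at h
  have h2 := hup v
  have h3 : M⁻¹ * (M⁻¹ * (v ⬝ᵥ D *ᵥ v)) ≤ M⁻¹ * (v ⬝ᵥ v) := by
    refine mul_le_mul_of_nonneg_left ?_ (by positivity)
    rw [inv_mul_le_iff₀ hpos]; exact h2
  linarith

lemma exists_upper {d : ℕ} (D : Matrix (Fin d) (Fin d) ℝ) :
    ∃ c : ℝ, 0 < c ∧ ∀ v, v ⬝ᵥ D *ᵥ v ≤ c * (v ⬝ᵥ v) := by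
  refine ⟨∑ i, ∑ j, |D i j| + 1, by positivity, fun v => ?_⟩
  have hsq : ∀ i, v i ^ 2 ≤ v ⬝ᵥ v := fun i => by
    have := Finset.single_le_sum (f := fun i => v i * v i)
      (fun j _ => mul_self_nonneg (v j)) (Finset.mem_univ i)
    simpa [dotProduct, sq] using this
  have hn : 0 ≤ v ⬝ᵥ v := by simpa using dotProduct_star_self_nonneg v
  have : v ⬝ᵥ D *ᵥ v ≤ ∑ i, ∑ j, |D i j| * (v ⬝ᵥ v) := by
    simp only [dotProduct, mulVec, Finset.mul_sum]
    refine Finset.sum_le_sum fun i _ => Finset.sum_le_sum fun j _ => ?_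
    rw [← Finset.mul_sum]
    change _ ≤ |D i j| * (v ⬝ᵥ v)
    have h1 : v i * v j ≤ v ⬝ᵥ v := by nlinarith [hsq i, hsq j, sq_nonneg (v i - v j)]
    have h2 : -(v i * v j) ≤ v ⬝ᵥ v := by nlinarith [hsq i, hsq j, sq_nonneg (v i + v j)]
    calc v i * (D i j * v j) ≤ |v i * (D i j * v j)| := le_abs_self _
      _ = |D i j| * |v i * v j| := by rw [← abs_mul]; congr 1; ring
      _ ≤ _ := mul_le_mul_of_nonneg_left (abs_le.2 ⟨by linarith, h1⟩) (abs_nonneg _)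
  rw [add_mul, Finset.sum_mul]
  simp only [Finset.sum_mul]
  linarith

lemma form_gammaPlus {dy du : ℕ} (Γ : Matrix (Fin dy) (Fin dy) ℝ) (w : Fin (dy + du) → ℝ) :
    w ⬝ᵥ (gammaPlus Γ : Matrix (Fin (dy + du)) (Fin (dy + du)) ℝ) *ᵥ w =
      (fun i => w (Fin.castAdd du i)) ⬝ᵥ Γ *ᵥ (fun i => w (Fin.castAdd du i)) +
      (fun i => w (Fin.natAdd dy i)) ⬝ᵥ (fun i => w (Fin.natAdd dy i)) := by
  simp [dotProduct, mulVec, gammaPlus, Fin.sum_univ_add, Matrix.one_apply]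

lemma gammaPlus_posDef {dy du : ℕ} (Γ : Matrix (Fin dy) (Fin dy) ℝ) (hΓ : Γ.PosDef) :
    (gammaPlus Γ : Matrix (Fin (dy + du)) (Fin (dy + du)) ℝ).PosDef := by
  refine .of_dotProduct_mulVec_pos ?_ fun w hw => ?_
  · have := hΓ.isHermitian.eq
    rw [Matrix.IsHermitian]
    simp only [gammaPlus, Matrix.reindex_apply, Matrix.conjTranspose_submatrix,
      Matrix.fromBlocks_conjTranspose, this]
    simp
  · rw [star_trivial, form_gammaPlus]
    have h2 : 0 ≤ (fun i => w (Fin.natAdd dy i)) ⬝ᵥ (fun i => w (Fin.natAdd dy i)) := by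
      simpa using dotProduct_star_self_nonneg (fun i => w (Fin.natAdd dy i))
    have h1 := hΓ.posSemidef.dotProduct_mulVec_nonneg (fun i => w (Fin.castAdd du i))
    simp only [star_trivial] at h1
    by_cases hz : (fun i => w (Fin.castAdd du i)) = 0
    · have : (fun i => w (Fin.natAdd dy i)) ≠ 0 := by
        intro h0
        apply hw
        funext i
        refine Fin.addCases (fun j => ?_) (fun j => ?_) i
        · exact congrFun hz j
        · exact congrFun h0 j
      have h3 : (fun i => w (Fin.natAdd dy i)) ⬝ᵥ (fun i => w (Fin.natAdd dy i)) ≠ 0 :=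
        fun h => this (dotProduct_self_eq_zero.1 h)
      have := lt_of_le_of_ne h2 h3.symm
      linarith
    · have := hΓ.dotProduct_mulVec_pos hz
      simp only [star_trivial] at this
      linarith

lemma sCov_cs {K p q : ℕ} (a : Fin K → Fin p → ℝ) (b : Fin K → Fin q → ℝ)
    (v : Fin p → ℝ) (w : Fin q → ℝ) :
    (v ⬝ᵥ (sCov a b) *ᵥ w) ^ 2 ≤ (v ⬝ᵥ (sCov a a) *ᵥ v) * (w ⬝ᵥ (sCov b b) *ᵥ w) := by
  simp only [form_sCov]
  have := Finset.sum_mul_sq_le_sq_mul_sq Finset.univ (fun i => v ⬝ᵥ (a i - sMean a))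
    (fun i => w ⬝ᵥ (b i - sMean b))
  simp only [← sq]
  rw [mul_pow]
  have hk : (0 : ℝ) ≤ ((K : ℝ)⁻¹) ^ 2 := by positivity
  nlinarith [mul_le_mul_of_nonneg_left this hk]

lemma sCov_nonneg {K p : ℕ} (a : Fin K → Fin p → ℝ) (v : Fin p → ℝ) :
    0 ≤ v ⬝ᵥ (sCov a a) *ᵥ v := by
  rw [form_sCov]
  exact mul_nonneg (by positivity) (Finset.sum_nonneg fun i _ => mul_self_nonneg _)

lemma sum_sub_mean_sq {K : ℕ} (f : Fin K → ℝ) (c : ℝ) :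
    ∑ i, (f i - (K : ℝ)⁻¹ * ∑ j, f j) ^ 2 ≤ ∑ i, (f i - c) ^ 2 := by
  rcases Nat.eq_zero_or_pos K with h | h
  · subst h; simp
  · have hK : (K : ℝ) ≠ 0 := by positivity
    set m := (K : ℝ)⁻¹ * ∑ j, f j with hm
    have hs : ∑ j, f j = K * m := by rw [hm]; field_simp
    have : ∑ i, (f i - c) ^ 2 - ∑ i, (f i - m) ^ 2 = K * (m - c) ^ 2 := by
      rw [← Finset.sum_sub_distrib]
      have : ∀ i, (f i - c) ^ 2 - (f i - m) ^ 2 = 2 * (m - c) * f i + (c ^ 2 - m ^ 2) :=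
        fun i => by ring
      simp only [this, Finset.sum_add_distrib, ← Finset.mul_sum, hs]
      simp
      ring
    have : 0 ≤ (K : ℝ) * (m - c) ^ 2 := by positivity
    linarith

lemma evNorm_sq {d : ℕ} (v : Fin d → ℝ) : evNorm v ^ 2 = v ⬝ᵥ v := by
  unfold evNorm
  rw [Real.sq_sqrt (Finset.sum_nonneg fun i _ => sq_nonneg _)]
  simp [dotProduct, sq]

lemma evNorm_nonneg {d : ℕ} (v : Fin d → ℝ) : 0 ≤ evNorm v := Real.sqrt_nonneg _

lemma dot_self_nonneg {d : ℕ} (v : Fin d → ℝ) : 0 ≤ v ⬝ᵥ v := by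
  rw [← evNorm_sq]; positivity

lemma Cpp_upper {K du dy : ℕ} (G : (Fin du → ℝ) → Fin dy → ℝ) (u : Fin K → Fin du → ℝ)
    (M₁ c : ℝ)
    (hLip : ∀ x x', evNorm (aug G x - aug G x') ≤ M₁ * evNorm (x - x'))
    (hc : ∀ v, v ⬝ᵥ Cuu u *ᵥ v ≤ c * (v ⬝ᵥ v)) (w : Fin (dy + du) → ℝ) :
    w ⬝ᵥ Cpp G u *ᵥ w ≤ M₁ ^ 2 * (du * c) * (w ⬝ᵥ w) := by
  have htr : (K : ℝ)⁻¹ * ∑ i, (u i - sMean u) ⬝ᵥ (u i - sMean u) ≤ du * c := by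
    have h1 : (K : ℝ)⁻¹ * ∑ i, (u i - sMean u) ⬝ᵥ (u i - sMean u) =
        ∑ j : Fin du, (Pi.single j 1 : Fin du → ℝ) ⬝ᵥ Cuu u *ᵥ (Pi.single j 1) := by
      unfold Cuu
      simp only [form_sCov]
      simp only [single_one_dotProduct]
      rw [← Finset.mul_sum, Finset.sum_comm]
      rfl
    rw [h1]
    calc _ ≤ ∑ j : Fin du, c * ((Pi.single j 1 : Fin du → ℝ) ⬝ᵥ (Pi.single j 1)) :=
          Finset.sum_le_sum fun j _ => hc _
      _ = du * c := by simp
  unfold Cpp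
  rw [form_sCov]
  set b : Fin K → Fin (dy + du) → ℝ := fun i => aug G (u i) with hb
  have hm : ∀ i, w ⬝ᵥ (b i - sMean b) = w ⬝ᵥ b i - (K : ℝ)⁻¹ * ∑ j, w ⬝ᵥ b j := by
    intro i
    rw [dotProduct_sub, sMean, dotProduct_smul, dotProduct_sum, smul_eq_mul]
  have hK : (0 : ℝ) ≤ (K : ℝ)⁻¹ := by positivity
  calc (K : ℝ)⁻¹ * ∑ i, (w ⬝ᵥ (b i - sMean b)) * (w ⬝ᵥ (b i - sMean b))
      = (K : ℝ)⁻¹ * ∑ i, (w ⬝ᵥ b i - (K : ℝ)⁻¹ * ∑ j, w ⬝ᵥ b j) ^ 2 := by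
        simp only [hm, sq]
    _ ≤ (K : ℝ)⁻¹ * ∑ i, (w ⬝ᵥ b i - w ⬝ᵥ aug G (sMean u)) ^ 2 :=
        mul_le_mul_of_nonneg_left (sum_sub_mean_sq (fun i => w ⬝ᵥ b i) _) hK
    _ ≤ (K : ℝ)⁻¹ * ∑ i, (w ⬝ᵥ w) * (M₁ ^ 2 * ((u i - sMean u) ⬝ᵥ (u i - sMean u))) := by
        refine mul_le_mul_of_nonneg_left (Finset.sum_le_sum fun i _ => ?_) hK
        rw [← dotProduct_sub]
        have h1 : (w ⬝ᵥ (b i - aug G (sMean u))) ^ 2 ≤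
            (w ⬝ᵥ w) * ((b i - aug G (sMean u)) ⬝ᵥ (b i - aug G (sMean u))) := by
          have := Finset.sum_mul_sq_le_sq_mul_sq Finset.univ w (b i - aug G (sMean u))
          simpa [dotProduct, sq] using this
        refine h1.trans (mul_le_mul_of_nonneg_left ?_ (dot_self_nonneg w))
        rw [← evNorm_sq, ← evNorm_sq, ← mul_pow]
        exact pow_le_pow_left₀ (evNorm_nonneg _) (hLip _ _) 2
    _ = (w ⬝ᵥ w) * M₁ ^ 2 * ((K : ℝ)⁻¹ * ∑ i, (u i - sMean u) ⬝ᵥ (u i - sMean u)) := by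
        simp only [← Finset.mul_sum]; ring
    _ ≤ (w ⬝ᵥ w) * M₁ ^ 2 * (du * c) :=
        mul_le_mul_of_nonneg_left htr (mul_nonneg (dot_self_nonneg w) (sq_nonneg _))
    _ = _ := by ring

lemma aug_dot {du dy : ℕ} (v : Fin du → ℝ) (y : Fin (dy + du) → ℝ) :
    (Fin.append (0 : Fin dy → ℝ) v) ⬝ᵥ y = v ⬝ᵥ (fun i => y (Fin.natAdd dy i)) := by
  simp [dotProduct, Fin.sum_univ_add]

lemma aug_centered {K du dy : ℕ} (G : (Fin du → ℝ) → Fin dy → ℝ) (u : Fin K → Fin du → ℝ)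
    (v : Fin du → ℝ) (i : Fin K) :
    (Fin.append (0 : Fin dy → ℝ) v) ⬝ᵥ (aug G (u i) - sMean (fun i => aug G (u i)))
      = v ⬝ᵥ (u i - sMean u) := by
  rw [aug_dot]
  congr 1
  funext j
  simp [aug, sMean, Finset.sum_apply]

lemma loewner_upper_iff {K d : ℕ} (u : Fin K → Fin d → ℝ) (c : ℝ)
    (h : ∀ v, v ⬝ᵥ Cuu u *ᵥ v ≤ c * (v ⬝ᵥ v)) : loewnerLE (Cuu u) (c • 1) := by
  refine .of_dotProduct_mulVec_nonneg ?_ fun v => ?_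
  · rw [Matrix.IsHermitian]; simp [Cuu, Matrix.conjTranspose_eq_transpose_of_trivial, sCov_transpose]
  · have := h v
    simp only [star_trivial, sub_mulVec, dotProduct_sub, smul_mulVec, one_mulVec, dotProduct_smul,
      smul_eq_mul]
    linarith

lemma loewner_lower_iff {K d : ℕ} (u : Fin K → Fin d → ℝ) (c : ℝ)
    (h : ∀ v, c * (v ⬝ᵥ v) ≤ v ⬝ᵥ Cuu u *ᵥ v) : loewnerLE (c • 1) (Cuu u) := by
  refine .of_dotProduct_mulVec_nonneg ?_ fun v => ?_
  · rw [Matrix.IsHermitian]; simp [Cuu, Matrix.conjTranspose_eq_transpose_of_trivial, sCov_transpose]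
  · have := h v
    simp only [star_trivial, sub_mulVec, dotProduct_sub, smul_mulVec, one_mulVec, dotProduct_smul,
      smul_eq_mul]
    linarith

lemma sCov_posSemidef {K d : ℕ} (u : Fin K → Fin d → ℝ) : (sCov u u).PosSemidef := by
  refine .of_dotProduct_mulVec_nonneg ?_ fun v => ?_
  · rw [Matrix.IsHermitian]; simp [Matrix.conjTranspose_eq_transpose_of_trivial, sCov_transpose]
  · simpa using sCov_nonneg u v

/-- Scalar inequality behind the upper bound. -/
lemma scalar_upper (n : ℕ) (hn : 1 ≤ n) (h₀ a γ β κ : ℝ) (hh₀ : 0 < h₀) (ha : 0 < a)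
    (hγ1 : γ ≤ 1) (hγ0 : 0 ≤ γ) (hβu : β ≤ γ) (hκ : 2 * a + 2 / h₀ ≤ κ) :
    κ * (n : ℝ) ^ (γ - β - 1) / (1 + (h₀ * (n : ℝ) ^ β) * (κ * (n : ℝ) ^ (γ - β - 1)))
      + a * (n : ℝ) ^ (2 * γ - β - 2) ≤ κ * ((n + 1 : ℕ) : ℝ) ^ (γ - β - 1) := by
  have hn0 : (0 : ℝ) < n := by exact_mod_cast hn
  have hn1 : (1 : ℝ) ≤ n := by exact_mod_cast hn
  set t : ℝ := (n : ℝ) ^ (γ - 1) with ht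
  set X : ℝ := (n : ℝ) ^ (γ - β - 1) with hX
  have hXpos : 0 < X := Real.rpow_pos_of_pos hn0 _
  have htpos : 0 < t := Real.rpow_pos_of_pos hn0 _
  have e1 : (n : ℝ) ^ β * X = t := by rw [hX, ht, ← Real.rpow_add hn0]; congr 1; ring
  have e2 : (n : ℝ) ^ (2 * γ - β - 2) = X * t := by
    rw [hX, ht, ← Real.rpow_add hn0]; congr 1; ring
  have ht1 : t ≤ 1 := Real.rpow_le_one_of_one_le_of_nonpos hn1 (by linarith)
  have htn : 1 / (n : ℝ) ≤ t := by
    rw [ht, one_div, ← Real.rpow_neg_one]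
    exact Real.rpow_le_rpow_of_exponent_le hn1 (by linarith)
  have hκ0 : 0 < κ := lt_of_lt_of_le (by positivity) hκ
  have e3 : X * (1 / (1 + t)) ≤ ((n + 1 : ℕ) : ℝ) ^ (γ - β - 1) := by
    have hsplit : ((n + 1 : ℕ) : ℝ) = n * (1 + 1 / n) := by push_cast; field_simp
    rw [hsplit, Real.mul_rpow hn0.le (by positivity)]
    refine mul_le_mul_of_nonneg_left ?_ hXpos.le
    have h1 : (1 : ℝ) ≤ 1 + 1 / n := by
      have : (0 : ℝ) ≤ 1 / n := by positivity
      linarith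
    calc 1 / (1 + t) ≤ 1 / (1 + 1 / (n : ℝ)) :=
          one_div_le_one_div_of_le (by positivity) (by linarith)
      _ = (1 + 1 / (n : ℝ)) ^ (-1 : ℝ) := by rw [Real.rpow_neg_one, one_div]
      _ ≤ _ := Real.rpow_le_rpow_of_exponent_le h1 (by linarith)
  have e4 : (h₀ * (n : ℝ) ^ β) * (κ * X) = h₀ * κ * t := by rw [← e1]; ring
  rw [e4, e2]
  refine le_trans ?_ (mul_le_mul_of_nonneg_left e3 hκ0.le)
  have e5 : κ / (1 + h₀ * κ * t) + a * t ≤ κ * (1 / (1 + t)) := by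
    have hk2 : 2 * a * h₀ + 2 ≤ κ * h₀ := by
      have := mul_le_mul_of_nonneg_right hκ hh₀.le
      have h3 : (2 * a + 2 / h₀) * h₀ = 2 * a * h₀ + 2 := by field_simp
      linarith
    have hk1 : 2 * a ≤ κ := le_trans (by have : 0 < 2 / h₀ := by positivity
                                         linarith) hκ
    have key : a * ((1 + t) * (1 + h₀ * κ * t)) ≤ κ * (h₀ * κ - 1) := by
      have p1 : (1 + t) * (1 + h₀ * κ * t) ≤ 2 * (1 + h₀ * κ) := by
        have hhk : 0 < h₀ * κ := by positivity
        refine mul_le_mul (by linarith) ?_ (by positivity) (by norm_num)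
        nlinarith
      have p2 := mul_le_mul_of_nonneg_left p1 ha.le
      have p3 : κ * 1 ≤ κ * (κ * h₀ - 2 * a * h₀ - 1) :=
        mul_le_mul_of_nonneg_left (by linarith) hκ0.le
      nlinarith
    have q : κ * (1 / (1 + t)) - (κ / (1 + h₀ * κ * t) + a * t) =
        t * (κ * (h₀ * κ - 1) - a * ((1 + t) * (1 + h₀ * κ * t))) /
          ((1 + t) * (1 + h₀ * κ * t)) := by
      have : 1 + h₀ * κ * t ≠ 0 := by positivity
      field_simp
      ring
    have : 0 ≤ t * (κ * (h₀ * κ - 1) - a * ((1 + t) * (1 + h₀ * κ * t))) /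
          ((1 + t) * (1 + h₀ * κ * t)) :=
      div_nonneg (mul_nonneg htpos.le (by linarith)) (by positivity)
    linarith
  calc κ * X / (1 + h₀ * κ * t) + a * (X * t) = X * (κ / (1 + h₀ * κ * t) + a * t) := by ring
    _ ≤ X * (κ * (1 / (1 + t))) := mul_le_mul_of_nonneg_left e5 hXpos.le
    _ = _ := by ring

/-- Scalar inequality behind the lower bound. -/
lemma scalar_lower (n : ℕ) (hn : 1 ≤ n) (L a γ β κ : ℝ) (hL : 0 ≤ L) (hκ0 : 0 < κ)
    (hs : γ - β - 1 ≤ 0) (hκ : κ * L ≤ a) :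
    κ * ((n + 1 : ℕ) : ℝ) ^ (γ - β - 1) ≤
    κ * (n : ℝ) ^ (γ - β - 1) / (1 + L * (n : ℝ) ^ (γ - 1))
      + a * (n : ℝ) ^ (2 * γ - β - 2) := by
  have hn0 : (0 : ℝ) < n := by exact_mod_cast hn
  set t : ℝ := (n : ℝ) ^ (γ - 1) with ht
  have e2 : (n : ℝ) ^ (2 * γ - β - 2) = (n : ℝ) ^ (γ - β - 1) * t := by
    rw [ht, ← Real.rpow_add hn0]; congr 1; ring
  have hmon : ((n + 1 : ℕ) : ℝ) ^ (γ - β - 1) ≤ (n : ℝ) ^ (γ - β - 1) :=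
    Real.rpow_le_rpow_of_nonpos hn0 (by push_cast; linarith) hs
  rw [e2]
  set X : ℝ := (n : ℝ) ^ (γ - β - 1) with hX
  have hXpos : 0 < X := Real.rpow_pos_of_pos hn0 _
  have htpos : 0 < t := Real.rpow_pos_of_pos hn0 _
  have hp : 0 < 1 + L * t := by positivity
  refine (mul_le_mul_of_nonneg_left hmon hκ0.le).trans ?_
  have q : κ * X / (1 + L * t) + a * (X * t) - κ * X =
      X * t * ((a - κ * L) + a * L * t) / (1 + L * t) := by
    field_simp
    ring
  have ha : 0 ≤ a := le_trans (by positivity) hκ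
  have : 0 ≤ X * t * ((a - κ * L) + a * L * t) / (1 + L * t) :=
    div_nonneg (mul_nonneg (by positivity) (add_nonneg (by linarith) (by positivity))) hp.le
  linarith

/-- Theorem: ensemble covariance bounds for Tikhonov EKI.
Under the Tikhonov EKI setup (normalized, `Σ = I`) with the regularity assumption on the
augmented map `H = aug G`, there exist constants `κm, κM > 0` such that for every `n ≥ 1`,
`κm n^(γ-β-1) I ⪯ Cⁿᵘᵘ ⪯ κM n^(γ-β-1) I` in the Loewner order. -/
theorem eki_covariance_bounds
    {du dy K : ℕ}
    (G : (Fin du → ℝ) → Fin dy → ℝ)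
    (M₁ M₂ : ℝ) (hM₁ : 0 < M₁) (hM₂ : 0 < M₂)
    (hreg : ContDiff ℝ 2 (aug G))
    (hJ : ∀ x, spNorm (jac (aug G) x) ≤ M₁)
    (hLip : ∀ x x', evNorm (aug G x - aug G x') ≤ M₁ * evNorm (x - x'))
    (hTay : ∀ x x',
      evNorm (aug G x' - aug G x - (jac (aug G) x).mulVec (x' - x)) ≤ M₂ * evNorm (x' - x) ^ 2)
    (Γ : Matrix (Fin dy) (Fin dy) ℝ) (hΓ : Γ.PosDef)
    (z : Fin (dy + du) → ℝ)
    (h₀ α₀ γ β : ℝ) (hh₀ : 0 < h₀) (hα₀ : 0 < α₀)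
    (hγ0 : 0 ≤ γ) (hγ1 : γ ≤ 1) (hβl : γ - 1 ≤ β) (hβu : β ≤ γ)
    (u : ℕ → Fin K → Fin du → ℝ)
    (hC1 : (Cuu (u 1)).PosDef)
    (hmean : ∀ n : ℕ, 1 ≤ n →
      sMean (u (n + 1)) = sMean (u n) +
        (Cup G (u n) *
          (Cpp G (u n) + (h₀ * (n : ℝ) ^ β)⁻¹ • gammaPlus Γ)⁻¹).mulVec
            (z - aug G (sMean (u n))))
    (hcov : ∀ n : ℕ, 1 ≤ n →
      Cuu (u (n + 1)) = Cuu (u n) -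
        Cup G (u n) * (Cpp G (u n) + (h₀ * (n : ℝ) ^ β)⁻¹ • gammaPlus Γ)⁻¹ * (Cup G (u n))ᵀ +
        (α₀ ^ 2 * h₀⁻¹ * (n : ℝ) ^ (2 * γ - β - 2)) • 1) :
    ∃ κm κM : ℝ, 0 < κm ∧ 0 < κM ∧ ∀ n : ℕ, 1 ≤ n →
      loewnerLE ((κm * (n : ℝ) ^ (γ - β - 1)) • 1) (Cuu (u n)) ∧
      loewnerLE (Cuu (u n)) ((κM * (n : ℝ) ^ (γ - β - 1)) • 1) := by
  classical
  have hS : ∀ n : ℕ, 1 ≤ n →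
      (Cpp G (u n) + (h₀ * (n : ℝ) ^ β)⁻¹ • gammaPlus Γ).PosDef := by
    intro n hn
    have hn0 : (0 : ℝ) < n := by exact_mod_cast hn
    have : 0 < (h₀ * (n : ℝ) ^ β)⁻¹ := inv_pos.2 (mul_pos hh₀ (Real.rpow_pos_of_pos hn0 _))
    exact Matrix.PosDef.posSemidef_add (sCov_posSemidef _) ((gammaPlus_posDef Γ hΓ).smul this)
  have hstep : ∀ n : ℕ, 1 ≤ n → ∀ v, v ⬝ᵥ Cuu (u (n + 1)) *ᵥ v =
      v ⬝ᵥ Cuu (u n) *ᵥ v - v ⬝ᵥ (Cup G (u n) *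
        (Cpp G (u n) + (h₀ * (n : ℝ) ^ β)⁻¹ • gammaPlus Γ)⁻¹ * (Cup G (u n))ᵀ) *ᵥ v +
      (α₀ ^ 2 * h₀⁻¹ * (n : ℝ) ^ (2 * γ - β - 2)) * (v ⬝ᵥ v) := by
    intro n hn v
    rw [hcov n hn]
    simp only [add_mulVec, sub_mulVec, dotProduct_add, dotProduct_sub, smul_mulVec, one_mulVec,
      dotProduct_smul, smul_eq_mul]
  obtain ⟨c1, hc1, hc1'⟩ := exists_upper (Cuu (u 1))
  obtain ⟨d1, hd1, hd1'⟩ := posDef_lower _ hC1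
  obtain ⟨g, hg, hg'⟩ := posDef_lower _ (gammaPlus_posDef (du := du) Γ hΓ)
  set a : ℝ := α₀ ^ 2 * h₀⁻¹ with ha
  have hapos : 0 < a := by positivity
  set κM : ℝ := c1 + 2 * a + 2 / h₀ with hκM
  have hκMpos : 0 < κM := by positivity
  have hup : ∀ n : ℕ, 1 ≤ n → ∀ v,
      v ⬝ᵥ Cuu (u n) *ᵥ v ≤ (κM * (n : ℝ) ^ (γ - β - 1)) * (v ⬝ᵥ v) := by
    intro n hn
    induction n, hn using Nat.le_induction with
    | base =>
      intro v
      refine (hc1' v).trans ?_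
      simp only [Nat.cast_one, Real.one_rpow, mul_one]
      refine mul_le_mul_of_nonneg_right ?_ (dot_self_nonneg v)
      have : 0 < 2 / h₀ := by positivity
      linarith
    | succ n hn ih =>
      intro v
      have hn0 : (0 : ℝ) < n := by exact_mod_cast hn
      have hXpos : 0 < (n : ℝ) ^ (γ - β - 1) := Real.rpow_pos_of_pos hn0 _
      have hbpos : 0 < (n : ℝ) ^ β := Real.rpow_pos_of_pos hn0 _
      have hB : v ⬝ᵥ Cup G (u n) *ᵥ (Fin.append (0 : Fin dy → ℝ) v) = v ⬝ᵥ Cuu (u n) *ᵥ v := by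
        unfold Cup Cuu
        rw [form_sCov, form_sCov]
        simp only [aug_centered]
      have hSx : (Fin.append (0 : Fin dy → ℝ) v) ⬝ᵥ
          (Cpp G (u n) + (h₀ * (n : ℝ) ^ β)⁻¹ • gammaPlus Γ) *ᵥ (Fin.append (0 : Fin dy → ℝ) v) =
          v ⬝ᵥ Cuu (u n) *ᵥ v + (h₀ * (n : ℝ) ^ β)⁻¹ * (v ⬝ᵥ v) := by
        simp only [add_mulVec, dotProduct_add, smul_mulVec, dotProduct_smul, smul_eq_mul,
          form_gammaPlus]
        congr 1
        · unfold Cpp Cuu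
          rw [form_sCov, form_sCov]
          simp only [aug_centered]
        · simp [dotProduct]
      have h1 := cov_upper (Cuu (u n)) (Cup G (u n)) (Cpp G (u n)) _ (hS n hn) v
        (Fin.append (0 : Fin dy → ℝ) v) (κM * (n : ℝ) ^ (γ - β - 1)) (h₀ * (n : ℝ) ^ β)
        (by positivity) (by positivity) (ih v) hB hSx
      have h2 := scalar_upper n hn h₀ a γ β κM hh₀ hapos hγ1 hγ0 hβu (by linarith)
      have h3 := mul_le_mul_of_nonneg_right h2 (dot_self_nonneg v)
      rw [hstep n hn v]
      linarith
  set L : ℝ := M₁ ^ 2 * (du * κM) * h₀ / g with hL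
  have hL0 : 0 ≤ L := by positivity
  set κm : ℝ := min d1 (a / (L + 1)) with hκm
  have hκmpos : 0 < κm := lt_min hd1 (by positivity)
  have hκmL : κm * L ≤ a := by
    have h1 : κm ≤ a / (L + 1) := min_le_right _ _
    have h2 := (le_div_iff₀ (by positivity)).1 h1
    nlinarith
  have hlow : ∀ n : ℕ, 1 ≤ n → ∀ v,
      (κm * (n : ℝ) ^ (γ - β - 1)) * (v ⬝ᵥ v) ≤ v ⬝ᵥ Cuu (u n) *ᵥ v := by
    intro n hn
    induction n, hn using Nat.le_induction with
    | base =>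
      intro v
      refine le_trans ?_ (hd1' v)
      simp only [Nat.cast_one, Real.one_rpow, mul_one]
      exact mul_le_mul_of_nonneg_right (min_le_left _ _) (dot_self_nonneg v)
    | succ n hn ih =>
      intro v
      have hn0 : (0 : ℝ) < n := by exact_mod_cast hn
      have hXpos : 0 < (n : ℝ) ^ (γ - β - 1) := Real.rpow_pos_of_pos hn0 _
      have hbpos : 0 < (n : ℝ) ^ β := Real.rpow_pos_of_pos hn0 _
      have htpos : 0 < (n : ℝ) ^ (γ - 1) := Real.rpow_pos_of_pos hn0 _
      have h1 := cov_lower (Cuu (u n)) (Cup G (u n)) (Cpp G (u n)) _ (hS n hn) v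
        (M₁ ^ 2 * (du * (κM * (n : ℝ) ^ (γ - β - 1)))) ((h₀ * (n : ℝ) ^ β)⁻¹ * g)
        (by positivity) (by positivity) (sCov_nonneg _ v)
        (Cpp_upper G (u n) M₁ _ hLip (hup n hn))
        (fun w => by
          have := mul_le_mul_of_nonneg_left (hg' w)
            (show 0 ≤ (h₀ * (n : ℝ) ^ β)⁻¹ by positivity)
          simp only [add_mulVec, dotProduct_add, smul_mulVec, dotProduct_smul, smul_eq_mul]
          linarith)
        (fun w => sCov_cs _ _ v w)
      have e1 : (n : ℝ) ^ β * (n : ℝ) ^ (γ - β - 1) = (n : ℝ) ^ (γ - 1) := by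
        rw [← Real.rpow_add hn0]; congr 1; ring
      have e2 : M₁ ^ 2 * (du * (κM * (n : ℝ) ^ (γ - β - 1))) / ((h₀ * (n : ℝ) ^ β)⁻¹ * g) =
          L * (n : ℝ) ^ (γ - 1) := by
        rw [hL, ← e1]; field_simp
      rw [e2] at h1
      have h2 := scalar_lower n hn L a γ β κm hL0 hκmpos (by linarith) hκmL
      have h3 := mul_le_mul_of_nonneg_right h2 (dot_self_nonneg v)
      have h4 : (κm * (n : ℝ) ^ (γ - β - 1)) * (v ⬝ᵥ v) / (1 + L * (n : ℝ) ^ (γ - 1)) ≤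
          (v ⬝ᵥ Cuu (u n) *ᵥ v) / (1 + L * (n : ℝ) ^ (γ - 1)) :=
        div_le_div_of_nonneg_right (ih v) (by positivity)
      rw [hstep n hn v]
      rw [add_mul, div_mul_eq_mul_div] at h3
      linarith
  exact ⟨κm, κM, hκmpos, hκMpos, fun n hn =>
    ⟨loewner_lower_iff _ _ (hlow n hn), loewner_upper_iff _ _ (hup n hn)⟩⟩
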